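/- Let X be a complex vector space and K ⊆ M_∞(X). Then K is matrix convex if and only if α*uα + β*vβ ∈ K for all u, v ∈ K and all α, β ∈ M_∞ with ‖α*α + β*β‖ ≤ 1. -/

import Mathlib

noncomputable section
open scoped ComplexConjugate ComplexOrder Matrix
open Matrix

namespace OSDual

/-- Entries vanish outside some finite corner. -/
def EvZero {X : Type*} [Zero X] (f : ℕ → ℕ → X) : Prop :=
  ∃ n : ℕ, ∀ i j : ℕ, n ≤ i ∨ n ≤ j → f i j = 0

variable (X : Type*) [AddCommGroup X] [Module ℂ X]

/-- `M_∞(X)`, realized as the space of `ℕ × ℕ`-indexed arrays with entries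
vanishing outside a finite corner. -/
def MatInfSub : Submodule ℂ (ℕ → ℕ → X) where
  carrier := {f | EvZero f}
  zero_mem' := ⟨0, fun _ _ _ => rfl⟩
  add_mem' := by
    rintro f g ⟨m, hm⟩ ⟨k, hk⟩
    refine ⟨max m k, fun i j h => ?_⟩
    have h1 : m ≤ i ∨ m ≤ j := by
      rcases h with h | h
      · exact Or.inl (le_trans (le_max_left _ _) h)
      · exact Or.inr (le_trans (le_max_left _ _) h)
    have h2 : k ≤ i ∨ k ≤ j := by
      rcases h with h | h
      · exact Or.inl (le_trans (le_max_right _ _) h)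
      · exact Or.inr (le_trans (le_max_right _ _) h)
    simp only [Pi.add_apply, hm i j h1, hk i j h2, add_zero]
  smul_mem' := by
    rintro c f ⟨m, hm⟩
    exact ⟨m, fun i j h => by simp only [Pi.smul_apply, hm i j h, smul_zero]⟩

/-- `M_∞(X)` as a type. -/
abbrev MatInf := ↥(MatInfSub X)

variable {X}

lemma mem_MatInfSub {f : ℕ → ℕ → X} : f ∈ MatInfSub X ↔ EvZero f := Iff.rfl

/-- The canonical inclusion of `M_m(X)` into `M_∞(X)` (padding with zeroes). -/
def ofMat {m : ℕ} (A : Matrix (Fin m) (Fin m) X) : MatInf X :=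
  ⟨fun i j => if h : i < m ∧ j < m then A ⟨i, h.1⟩ ⟨j, h.2⟩ else 0,
   ⟨m, by
      intro i j h
      dsimp only
      rw [dif_neg]
      rintro ⟨h1, h2⟩
      rcases h with h | h <;> omega⟩⟩

/-- The inclusion of `X = M_1(X)` into `M_∞(X)`. -/
def ofMat1 (x : X) : MatInf X := ofMat (m := 1) (fun _ _ => x)

/-- The truncation of an element of `M_∞(X)` to an `m × m` matrix. -/
def trunc (m : ℕ) (x : MatInf X) : Matrix (Fin m) (Fin m) X :=
  fun i j => x.1 (i : ℕ) (j : ℕ)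

/-- The conjugate transpose on scalar matrices `M_∞ = M_∞(ℂ)`. -/
def adjc (α : MatInf ℂ) : MatInf ℂ :=
  ⟨fun i j => conj (α.1 j i), by
    obtain ⟨m, hm⟩ := α.2
    exact ⟨m, fun i j h => by dsimp only; rw [hm j i h.symm, map_zero]⟩⟩

/-- Product of two scalar matrices in `M_∞`. -/
def cmul (α β : MatInf ℂ) : MatInf ℂ :=
  ⟨fun i j => ∑ᶠ k, α.1 i k * β.1 k j, by
    obtain ⟨m, hm⟩ := α.2
    obtain ⟨r, hr⟩ := β.2
    refine ⟨max m r, fun i j h => finsum_eq_zero_of_forall_eq_zero fun k => ?_⟩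
    rcases h with h | h
    · rw [hm i k (Or.inl (le_trans (le_max_left _ _) h)), zero_mul]
    · rw [hr k j (Or.inr (le_trans (le_max_right _ _) h)), mul_zero]⟩

/-- The two-sided product `α x β` of an element `x ∈ M_∞(X)` with scalar
matrices `α, β ∈ M_∞`. -/
def sandwich (α : MatInf ℂ) (x : MatInf X) (β : MatInf ℂ) : MatInf X :=
  ⟨fun i j => ∑ᶠ k, ∑ᶠ l, (α.1 i k * β.1 l j) • x.1 k l, by
    obtain ⟨m, hm⟩ := α.2
    obtain ⟨r, hr⟩ := β.2
    refine ⟨max m r, fun i j h => finsum_eq_zero_of_forall_eq_zero fun k =>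
      finsum_eq_zero_of_forall_eq_zero fun l => ?_⟩
    rcases h with h | h
    · rw [hm i k (Or.inl (le_trans (le_max_left _ _) h)), zero_mul, zero_smul]
    · rw [hr l j (Or.inr (le_trans (le_max_right _ _) h)), mul_zero, zero_smul]⟩

/-- `α*α + β*β` for scalar matrices. -/
def coSq (α β : MatInf ℂ) : MatInf ℂ := cmul (adjc α) α + cmul (adjc β) β

/-- A projection in `M_∞`. -/
def IsProjection (p : MatInf ℂ) : Prop := adjc p = p ∧ cmul p p = p

/-- A subset `K ⊆ M_∞(X)` is matrix convex if `α* u α + β* v β ∈ K` whenever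
`u, v ∈ K` and `α*α + β*β` is a non-zero projection. -/
def MatrixConvex (K : Set (MatInf X)) : Prop :=
  ∀ u ∈ K, ∀ v ∈ K, ∀ α β : MatInf ℂ,
    IsProjection (coSq α β) → coSq α β ≠ 0 →
      sandwich (adjc α) u α + sandwich (adjc β) v β ∈ K

/-- The operator norm of a finite complex matrix (acting on `ℓ²`). -/
def opN {ι : Type*} [Fintype ι] [DecidableEq ι] (A : Matrix ι ι ℂ) : ℝ :=
  ‖Matrix.toEuclideanCLM (𝕜 := ℂ) A‖

/-- The operator norm of an element of `M_∞ = M_∞(ℂ)` (acting on `ℓ²`). -/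
def cnorm (α : MatInf ℂ) : ℝ := ⨆ m : ℕ, opN (trunc m α)

/-- The involution on `M_∞(X)` induced by an involution on `X`. -/
def minfStar [StarAddMonoid X] [StarModule ℂ X] (x : MatInf X) : MatInf X :=
  ⟨fun i j => star (x.1 j i), by
    obtain ⟨m, hm⟩ := x.2
    exact ⟨m, fun i j h => by dsimp only; rw [hm j i h.symm, star_zero]⟩⟩

/-- The entrywise application `ψ^{(m)}` of a linear map `ψ : Z → M_n`,
followed by the identification `M_m(M_n) ≅ M_{mn}`. -/
def matApply {Z : Type*} [AddCommGroup Z] [Module ℂ Z] {n : ℕ}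
    (ψ : Z →ₗ[ℂ] Matrix (Fin n) (Fin n) ℂ) {m : ℕ} (w : Matrix (Fin m) (Fin m) Z) :
    Matrix (Fin m × Fin n) (Fin m × Fin n) ℂ :=
  fun p q => ψ (w p.1 q.1) p.2 q.2

/-- The real part of a complex matrix. -/
def matRe {ι : Type*} (A : Matrix ι ι ℂ) : Matrix ι ι ℂ := (2⁻¹ : ℂ) • (A + Aᴴ)

/-- `A ≤ I` in the positive semidefinite order. -/
def leOne {ι : Type*} [Fintype ι] [DecidableEq ι] (A : Matrix ι ι ℂ) : Prop :=
  ((1 : Matrix ι ι ℂ) - A).PosSemidef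

/-- `Re A ≤ I` in the positive semidefinite order. -/
def reLeOne {ι : Type*} [Fintype ι] [DecidableEq ι] (A : Matrix ι ι ℂ) : Prop :=
  leOne (matRe A)

lemma finsum_eq_sum_fin {M : Type*} [AddCommMonoid M] {n : ℕ} {f : ℕ → M}
    (hf : ∀ k, n ≤ k → f k = 0) : ∑ᶠ k, f k = ∑ k : Fin n, f k := by
  rw [Fin.sum_univ_eq_sum_range]
  refine finsum_eq_sum_of_support_subset _ fun k hk => ?_
  by_contra h
  exact hk (hf k (by simpa using h))

/-- `x` lies in the corner `M_n(X)`. -/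
def InCorner (n : ℕ) (x : MatInf X) : Prop :=
  ∀ i j : ℕ, n ≤ i ∨ n ≤ j → x.1 i j = 0

lemma exists_inCorner (x : MatInf X) : ∃ n, InCorner n x := x.2

lemma InCorner.mono {m n : ℕ} {x : MatInf X} (hx : InCorner m x) (h : m ≤ n) : InCorner n x :=
  fun i j hij => hx i j (hij.imp h.trans h.trans)

lemma InCorner.trunc_eq_zero_iff {n : ℕ} {x : MatInf X} (hx : InCorner n x) :
    trunc n x = 0 ↔ x = 0 := by
  refine ⟨fun h => ?_, fun h => by subst h; rfl⟩
  ext i j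
  by_cases hij : i < n ∧ j < n
  · exact congrFun (congrFun h ⟨i, hij.1⟩) ⟨j, hij.2⟩
  · exact hx i j (by omega)

lemma InCorner.adjc {n : ℕ} {α : MatInf ℂ} (hα : InCorner n α) : InCorner n (adjc α) :=
  fun i j h => by simp [OSDual.adjc, hα j i h.symm]

lemma InCorner.cmul {n : ℕ} {α β : MatInf ℂ} (hα : InCorner n α) (hβ : InCorner n β) :
    InCorner n (cmul α β) := fun i j h =>
  finsum_eq_zero_of_forall_eq_zero fun k => by
    rcases h with h | h
    · rw [hα i k (Or.inl h), zero_mul]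
    · rw [hβ k j (Or.inr h), mul_zero]

lemma trunc_adjc (n : ℕ) (α : MatInf ℂ) : trunc n (adjc α) = (trunc n α)ᴴ := rfl

lemma trunc_cmul {n : ℕ} {α : MatInf ℂ} (hα : InCorner n α) (β : MatInf ℂ) :
    trunc n (cmul α β) = trunc n α * trunc n β := by
  ext i j
  rw [Matrix.mul_apply]
  exact finsum_eq_sum_fin fun k hk => by rw [hα _ k (Or.inr hk), zero_mul]

lemma InCorner.coSq {n : ℕ} {α β : MatInf ℂ} (hα : InCorner n α) (hβ : InCorner n β) :
    InCorner n (coSq α β) := fun i j h =>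
  (congrArg₂ (· + ·) (hα.adjc.cmul hα i j h) (hβ.adjc.cmul hβ i j h)).trans (add_zero 0)

lemma trunc_coSq {n : ℕ} {α β : MatInf ℂ} (hα : InCorner n α) (hβ : InCorner n β) :
    trunc n (coSq α β) = (trunc n α)ᴴ * trunc n α + (trunc n β)ᴴ * trunc n β := by
  rw [← trunc_adjc, ← trunc_adjc, ← trunc_cmul hα.adjc, ← trunc_cmul hβ.adjc]
  rfl

section Norm

open scoped Matrix.Norms.L2Operator MatrixOrder

/-- The partial identity matrix of size `m × n`. -/
def partialId (m n : ℕ) : Matrix (Fin m) (Fin n) ℂ :=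
  Matrix.of fun i j => if (i : ℕ) = j then 1 else 0

lemma norm_partialId_le (m n : ℕ) : ‖partialId m n‖ ≤ 1 := by
  have h : (partialId m n)ᴴ * partialId m n =
      diagonal fun j : Fin n => if (j : ℕ) < m then 1 else 0 := by
    ext i j
    rw [Matrix.mul_apply, diagonal_apply]
    by_cases hi : (i : ℕ) < m
    · rw [Finset.sum_eq_single ⟨i, hi⟩]
      · simp [partialId, Fin.ext_iff, hi]
      · intro k _ hk
        have : (k : ℕ) ≠ i := fun h => hk (Fin.ext h)
        simp [partialId, this]
      · simp
    · rw [Finset.sum_eq_zero]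
      · simp [hi]
      · intro k _
        have : (k : ℕ) ≠ i := by omega
        simp [partialId, this]
  have h2 := l2_opNorm_conjTranspose_mul_self (partialId m n)
  rw [h, l2_opNorm_diagonal] at h2
  have h3 : ‖fun j : Fin n => if (j : ℕ) < m then (1 : ℂ) else 0‖ ≤ 1 :=
    (pi_norm_le_iff_of_nonneg zero_le_one).2 fun j => by split_ifs <;> simp
  nlinarith [norm_nonneg (partialId m n)]

lemma trunc_eq_partialId_mul {n : ℕ} {α : MatInf ℂ} (hα : InCorner n α) (m : ℕ) :
    trunc m α = partialId m n * trunc n α * (partialId m n)ᴴ := by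
  ext i j
  simp only [Matrix.mul_apply, conjTranspose_apply, partialId, of_apply]
  by_cases hij : (i : ℕ) < n ∧ (j : ℕ) < n
  · rw [Finset.sum_eq_single ⟨j, hij.2⟩, Finset.sum_eq_single ⟨i, hij.1⟩]
    · simp [trunc]
    · intro k _ hk
      have : (i : ℕ) ≠ k := fun h => hk (Fin.ext h.symm)
      simp [this]
    · simp
    · intro k _ hk
      have : (j : ℕ) ≠ k := fun h => hk (Fin.ext h.symm)
      simp [this]
    · simp
  · have : trunc m α i j = 0 := hα i j (by omega)
    rw [this]
    refine (Finset.sum_eq_zero fun l _ => ?_).symm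
    by_cases hj : (j : ℕ) = l
    · rw [Finset.sum_eq_zero, zero_mul]
      intro k _
      have : (i : ℕ) ≠ k := by omega
      simp [this]
    · simp [hj]

lemma opN_trunc_le {n : ℕ} {α : MatInf ℂ} (hα : InCorner n α) (m : ℕ) :
    opN (trunc m α) ≤ opN (trunc n α) := by
  change ‖trunc m α‖ ≤ ‖trunc n α‖
  rw [trunc_eq_partialId_mul hα m]
  have h := norm_partialId_le m n
  calc _ ≤ ‖partialId m n * trunc n α‖ * ‖(partialId m n)ᴴ‖ := l2_opNorm_mul _ _
    _ ≤ ‖partialId m n * trunc n α‖ * 1 := by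
      rw [l2_opNorm_conjTranspose]; gcongr
    _ ≤ ‖partialId m n‖ * ‖trunc n α‖ := by
      rw [mul_one]; exact l2_opNorm_mul _ _
    _ ≤ 1 * ‖trunc n α‖ := by gcongr
    _ = ‖trunc n α‖ := one_mul _

lemma cnorm_eq_opN_trunc {n : ℕ} {α : MatInf ℂ} (hα : InCorner n α) :
    cnorm α = opN (trunc n α) :=
  le_antisymm (ciSup_le (opN_trunc_le hα))
    (le_ciSup (f := fun m => opN (trunc m α))
      ⟨_, Set.forall_mem_range.2 (opN_trunc_le hα)⟩ n)

lemma IsProjection.cnorm_le_one {p : MatInf ℂ} (hp : IsProjection p) : cnorm p ≤ 1 := by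
  obtain ⟨n, hn⟩ := exists_inCorner p
  rw [cnorm_eq_opN_trunc hn]
  have h : IsStarProjection (trunc n p) :=
    ⟨by rw [IsIdempotentElem, ← trunc_cmul hn, hp.2],
      by rw [isSelfAdjoint_iff, star_eq_conjTranspose, ← trunc_adjc, hp.1]⟩
  exact h.norm_le

lemma exists_conjTranspose_mul_self_eq_one_sub {n : ℕ} {A : Matrix (Fin n) (Fin n) ℂ}
    (hA : A.PosSemidef) (h : opN A ≤ 1) :
    ∃ C : Matrix (Fin n) (Fin n) ℂ, Cᴴ * C = 1 - A := by
  have h1 : A ≤ 1 :=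
    (CStarAlgebra.norm_le_one_iff_of_nonneg A (nonneg_iff_posSemidef.2 hA)).1 h
  obtain ⟨C, hC⟩ := CStarAlgebra.nonneg_iff_eq_star_mul_self.1 (sub_nonneg.2 h1)
  exact ⟨C, hC.symm⟩

end Norm

lemma isProjection_of_trunc_eq_one {n : ℕ} {p : MatInf ℂ} (hp : InCorner n p)
    (h : trunc n p = 1) : IsProjection p := by
  constructor
  · rw [← sub_eq_zero, ← InCorner.trunc_eq_zero_iff (n := n)]
    · change trunc n (adjc p) - trunc n p = 0
      simp [trunc_adjc, h]
    · intro i j hij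
      change (adjc p).1 i j - p.1 i j = 0
      rw [hp.adjc i j hij, hp i j hij, sub_zero]
  · rw [← sub_eq_zero, ← InCorner.trunc_eq_zero_iff (n := n)]
    · change trunc n (cmul p p) - trunc n p = 0
      simp [trunc_cmul hp, h]
    · intro i j hij
      change (cmul p p).1 i j - p.1 i j = 0
      rw [hp.cmul hp i j hij, hp i j hij, sub_zero]

/-- The block column with upper block the `n × n` corner of `α` and lower block `C`. -/
def blockColumn {n : ℕ} (α : MatInf ℂ) (C : Matrix (Fin n) (Fin n) ℂ) : MatInf ℂ :=
  ⟨fun i j => if i < n then (if j < n then α.1 i j else 0) else (ofMat C).1 (i - n) j, by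
    refine ⟨n + n, fun i j h => ?_⟩
    dsimp only
    split_ifs with hi hj
    · omega
    · rfl
    · exact dif_neg (by omega)⟩

lemma blockColumn_apply_of_lt {n : ℕ} {α : MatInf ℂ} (hα : InCorner n α)
    (C : Matrix (Fin n) (Fin n) ℂ) {i : ℕ} (hi : i < n) (j : ℕ) :
    (blockColumn α C).1 i j = α.1 i j := by
  change (if i < n then (if j < n then α.1 i j else 0) else _) = _
  rw [if_pos hi]
  split_ifs with hj
  · rfl
  · exact (hα i j (Or.inr (not_lt.1 hj))).symm

lemma blockColumn_apply_add {n : ℕ} (α : MatInf ℂ) (C : Matrix (Fin n) (Fin n) ℂ) (i j : ℕ) :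
    (blockColumn α C).1 (n + i) j = (ofMat C).1 i j := by
  change (if n + i < n then _ else (ofMat C).1 (n + i - n) j) = _
  rw [if_neg (by omega), Nat.add_sub_cancel_left]

lemma inCorner_ofMat {n : ℕ} (A : Matrix (Fin n) (Fin n) X) : InCorner n (ofMat A) :=
  fun _ _ h => dif_neg (by omega)

lemma trunc_ofMat {n : ℕ} (A : Matrix (Fin n) (Fin n) X) : trunc n (ofMat A) = A := by
  ext i j
  exact dif_pos ⟨i.2, j.2⟩

lemma cmul_adjc_blockColumn {n : ℕ} {α : MatInf ℂ} (hα : InCorner n α)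
    (C : Matrix (Fin n) (Fin n) ℂ) :
    cmul (adjc (blockColumn α C)) (blockColumn α C) = coSq α (ofMat C) := by
  ext i j
  change ∑ᶠ k, conj ((blockColumn α C).1 k i) * (blockColumn α C).1 k j =
    ∑ᶠ k, conj (α.1 k i) * α.1 k j + ∑ᶠ k, conj ((ofMat C).1 k i) * (ofMat C).1 k j
  rw [finsum_eq_sum_fin (n := n + n), finsum_eq_sum_fin (n := n), finsum_eq_sum_fin (n := n),
    Fin.sum_univ_add]
  · simp only [Fin.val_castAdd, Fin.val_natAdd, blockColumn_apply_add, Fin.is_lt,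
      blockColumn_apply_of_lt hα]
  · intro k hk
    rw [inCorner_ofMat C k j (Or.inl hk), mul_zero]
  · intro k hk
    rw [hα k j (Or.inl hk), mul_zero]
  · intro k hk
    obtain ⟨l, rfl⟩ := Nat.exists_eq_add_of_le (show n ≤ k by omega)
    rw [blockColumn_apply_add, blockColumn_apply_add, inCorner_ofMat C l j (Or.inl (by omega)),
      mul_zero]

lemma sandwich_blockColumn {n : ℕ} {u : MatInf X} (hu : InCorner n u) {α : MatInf ℂ}
    (hα : InCorner n α) (C : Matrix (Fin n) (Fin n) ℂ) :
    sandwich (adjc (blockColumn α C)) u (blockColumn α C) = sandwich (adjc α) u α := by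
  ext i j
  refine finsum_congr fun k => finsum_congr fun l => ?_
  by_cases hkl : k < n ∧ l < n
  · change (conj ((blockColumn α C).1 k i) * (blockColumn α C).1 l j) • _ =
      (conj (α.1 k i) * α.1 l j) • _
    rw [blockColumn_apply_of_lt hα C hkl.1, blockColumn_apply_of_lt hα C hkl.2]
  · rw [hu k l (by omega), smul_zero, smul_zero]

lemma MatrixConvex.sandwich_add_sandwich_mem {K : Set (MatInf X)} (hK : MatrixConvex K)
    {u v : MatInf X} (hu : u ∈ K) (hv : v ∈ K) {α β : MatInf ℂ} (h : cnorm (coSq α β) ≤ 1) :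
    sandwich (adjc α) u α + sandwich (adjc β) v β ∈ K := by
  obtain ⟨a, ha⟩ := exists_inCorner α
  obtain ⟨b, hb⟩ := exists_inCorner β
  obtain ⟨c, hc⟩ := exists_inCorner u
  obtain ⟨n, hn⟩ : ∃ n, n = a + b + c + 1 := ⟨_, rfl⟩
  replace ha : InCorner n α := ha.mono (by omega)
  replace hb : InCorner n β := hb.mono (by omega)
  replace hc : InCorner n u := hc.mono (by omega)
  rw [cnorm_eq_opN_trunc (ha.coSq hb), trunc_coSq ha hb] at h
  obtain ⟨C, hC⟩ := exists_conjTranspose_mul_self_eq_one_sub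
    ((posSemidef_conjTranspose_mul_self _).add (posSemidef_conjTranspose_mul_self _)) h
  have hsq : coSq (blockColumn α C) β = coSq α (ofMat C) + cmul (adjc β) β := by
    rw [coSq, cmul_adjc_blockColumn ha]
  have hcor : InCorner n (coSq (blockColumn α C) β) := fun i j hij => by
    rw [hsq]
    exact (congrArg₂ (· + ·) (ha.coSq (inCorner_ofMat C) i j hij)
      (hb.adjc.cmul hb i j hij)).trans (add_zero 0)
  have hone : trunc n (coSq (blockColumn α C) β) = 1 := by
    rw [hsq]
    change trunc n (coSq α (ofMat C)) + trunc n (cmul (adjc β) β) = 1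
    rw [trunc_coSq ha (inCorner_ofMat C), trunc_cmul hb.adjc, trunc_adjc, trunc_ofMat, hC]
    abel
  have hne : coSq (blockColumn α C) β ≠ 0 := by
    have : NeZero n := ⟨by omega⟩
    rw [Ne, ← hcor.trunc_eq_zero_iff, hone]
    exact one_ne_zero
  have := hK u hu v hv _ β (isProjection_of_trunc_eq_one hcor hone) hne
  rwa [sandwich_blockColumn hc ha] at this

/-- Lemma 2.4. Let `X` be a complex vector space and
`K ⊆ M_∞(X)`. Then `K` is matrix convex if and only if
`α* u α + β* v β ∈ K` for all `u, v ∈ K` and all `α, β ∈ M_∞` with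
`‖α*α + β*β‖ ≤ 1`. -/
theorem statement0 {X : Type*} [AddCommGroup X] [Module ℂ X] (K : Set (MatInf X)) :
    MatrixConvex K ↔
      ∀ u ∈ K, ∀ v ∈ K, ∀ α β : MatInf ℂ, cnorm (coSq α β) ≤ 1 →
        sandwich (adjc α) u α + sandwich (adjc β) v β ∈ K := by
  exact ⟨fun hK u hu v hv α β h => hK.sandwich_add_sandwich_mem hu hv h,
    fun hK u hu v hv α β h _ => hK u hu v hv α β h.cnorm_le_one⟩

end OSDual
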